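/- arXiv:2303.06772 — 2 statements merged into one kernel-verified Lean document; each statement's English description precedes it below -/
import Mathlib

section
/- Let n ≥ 2, let A be an n-by-n complex matrix that is convexoid, i.e., its field of values F(A) equals the convex hull of its spectrum. Let λ and μ be two distinct eigenvalues of A such that the closed segment [λ, μ] is contained in the topological boundary of F(A) (i.e., [λ, μ] is a side of the polygon ∂F(A)). Then for every index k ∈ {1, …, n}, the field of values of the principal submatrix A_{(k)} has nonempty intersection with the segment [λ, μ]. -/
open Matrix Complex

/-- The field of values (numerical range) of a complex matrix:
`F(A) = { x* A x : x* x = 1 }`. -/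
def fov {n : ℕ} (A : Matrix (Fin n) (Fin n) ℂ) : Set ℂ :=
  {z | ∃ x : Fin n → ℂ, star x ⬝ᵥ x = 1 ∧ star x ⬝ᵥ A.mulVec x = z}

/-- The principal submatrix `A_{(k)}` obtained by deleting the `k`-th row and column. -/
def subAt {n : ℕ} (A : Matrix (Fin (n + 1)) (Fin (n + 1)) ℂ) (k : Fin (n + 1)) :
    Matrix (Fin n) (Fin n) ℂ :=
  A.submatrix k.succAbove k.succAbove

lemma dot_self_real {n : ℕ} (x : Fin n → ℂ) :
    star x ⬝ᵥ x = ((∑ i, Complex.normSq (x i) : ℝ) : ℂ) := by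
  simp [dotProduct, Complex.normSq_eq_conj_mul_self]

lemma nsq_pos {n : ℕ} {x : Fin n → ℂ} (hx : x ≠ 0) : 0 < ∑ i, Complex.normSq (x i) := by
  obtain ⟨i, hi⟩ := Function.ne_iff.1 hx
  exact Finset.sum_pos' (fun i _ => Complex.normSq_nonneg _)
    ⟨i, Finset.mem_univ _, Complex.normSq_pos.2 hi⟩

lemma fov_of_ne {n : ℕ} (A : Matrix (Fin n) (Fin n) ℂ) {x : Fin n → ℂ} {r : ℝ} (hr : 0 < r)
    (h : star x ⬝ᵥ x = (r : ℂ)) : (star x ⬝ᵥ A.mulVec x) / (r : ℂ) ∈ fov A := by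
  have hs : ((Real.sqrt r : ℝ) : ℂ) * ((Real.sqrt r : ℝ) : ℂ) = r := by
    rw [← Complex.ofReal_mul, Real.mul_self_sqrt hr.le]
  have h0 : ((Real.sqrt r : ℝ) : ℂ) ≠ 0 := by
    exact_mod_cast (Real.sqrt_pos.2 hr).ne'
  refine ⟨((Real.sqrt r : ℝ) : ℂ)⁻¹ • x, ?_, ?_⟩
  · rw [star_smul, smul_dotProduct, dotProduct_smul, h, ← hs]
    simp
    field_simp
  · rw [star_smul, smul_dotProduct, mulVec_smul, dotProduct_smul, ← hs]
    simp
    field_simp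

lemma support_fun {S : Set ℂ} (hS : Convex ℝ S) {a : ℂ} (ha : a ∈ S) (hf : a ∉ interior S) :
    ∃ c : ℂ, c ≠ 0 ∧ ∀ z ∈ S, (c * (z - a)).re ≤ 0 := by
  suffices h : ∃ f : ℂ →ₗ[ℝ] ℝ, f ≠ 0 ∧ ∀ z ∈ S, f z ≤ f a by
    obtain ⟨f, hf0, hf⟩ := h
    have key : ∀ z, f z = z.re * f 1 + z.im * f I := by
      intro z
      conv_lhs => rw [show z = z.re • (1 : ℂ) + z.im • I by simp [Complex.re_add_im]]
      simp only [map_add, map_smul, smul_eq_mul]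
    refine ⟨⟨f 1, - f I⟩, ?_, ?_⟩
    · intro h
      apply hf0
      ext z
      have h1 : f 1 = 0 := by simpa using congrArg Complex.re h
      have h2 : f I = 0 := by simpa using congrArg Complex.im h
      rw [key]; simp [h1, h2]
    · intro z hz
      have := hf z hz
      rw [key z, key a] at this
      simp only [Complex.mul_re, Complex.sub_re, Complex.sub_im]
      linarith
  rcases (interior S).eq_empty_or_nonempty with he | hne
  · have h1 : affineSpan ℝ S ≠ ⊤ := by
      rw [Ne, ← hS.interior_nonempty_iff_affineSpan_eq_top, he]; simp
    have h2 : vectorSpan ℝ S < ⊤ := by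
      rw [lt_top_iff_ne_top]
      intro h
      exact h1 ((AffineSubspace.affineSpan_eq_top_iff_vectorSpan_eq_top_of_nonempty ℝ ℂ ℂ ⟨a, ha⟩).2 h)
    obtain ⟨f, hf0, hle⟩ := Submodule.exists_le_ker_of_lt_top _ h2
    refine ⟨f, hf0, fun z hz => ?_⟩
    have : f (z - a) = 0 := hle (vsub_mem_vectorSpan ℝ hz ha)
    rw [map_sub] at this
    linarith
  · obtain ⟨f, hf⟩ := geometric_hahn_banach_open_point hS.interior isOpen_interior hf
    refine ⟨f.toLinearMap, ?_, ?_⟩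
    · intro h
      obtain ⟨b, hb⟩ := hne
      have h3 := hf b hb
      have h4 : ∀ z, f z = 0 := fun z => LinearMap.congr_fun h z
      simp [h4] at h3
    · intro z hz
      have : z ∈ closure (interior S) := by
        rw [hS.closure_interior_eq_closure_of_nonempty_interior hne]
        exact subset_closure hz
      exact closure_minimal (t := {z | f z ≤ f a}) (fun b hb => (hf b hb).le)
        (isClosed_le f.continuous continuous_const) this

lemma exists_eigvec {n : ℕ} {A : Matrix (Fin n) (Fin n) ℂ} {l : ℂ} (h : l ∈ spectrum ℂ A) :
    ∃ v : Fin n → ℂ, v ≠ 0 ∧ A.mulVec v = l • v := by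
  rw [spectrum.mem_iff, Matrix.isUnit_iff_isUnit_det, isUnit_iff_ne_zero, not_not] at h
  obtain ⟨v, hv, h⟩ := Matrix.exists_mulVec_eq_zero_iff.2 h
  refine ⟨v, hv, ?_⟩
  rw [Matrix.sub_mulVec, sub_eq_zero, Algebra.algebraMap_eq_smul_one, Matrix.smul_mulVec,
    Matrix.one_mulVec] at h
  exact h.symm

lemma expand_dot {n : ℕ} (v w : Fin n → ℂ) (a b c d : ℂ) :
    star (a • v + b • w) ⬝ᵥ (c • v + d • w) =
      star a * c * (star v ⬝ᵥ v) + star a * d * (star v ⬝ᵥ w)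
        + star b * c * (star w ⬝ᵥ v) + star b * d * (star w ⬝ᵥ w) := by
  simp only [star_add, star_smul, add_dotProduct, dotProduct_add, smul_dotProduct,
    dotProduct_smul, smul_eq_mul]
  ring

lemma orth {n : ℕ} {A : Matrix (Fin n) (Fin n) ℂ} {l m c : ℂ} (hc : c ≠ 0) (hlm : l ≠ m)
    (H : ∀ z ∈ fov A, (c * (z - l)).re ≤ 0) {v w : Fin n → ℂ}
    (hv : A.mulVec v = l • v) (hw : A.mulVec w = m • w) : star v ⬝ᵥ w = 0 := by
  have H2 : ∀ x : Fin n → ℂ, (c * (star x ⬝ᵥ A.mulVec x - l * (star x ⬝ᵥ x))).re ≤ 0 := by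
    intro x
    by_cases hx : x = 0
    · simp [hx]
    · have hr := nsq_pos hx
      have hx' := dot_self_real x
      set r := ∑ i, Complex.normSq (x i)
      have h1 := H _ (fov_of_ne A hr hx')
      have hr' : (r : ℂ) ≠ 0 := by exact_mod_cast hr.ne'
      have : c * (star x ⬝ᵥ A.mulVec x - l * (star x ⬝ᵥ x)) =
          (r : ℂ) * (c * ((star x ⬝ᵥ A.mulVec x) / (r : ℂ) - l)) := by
        rw [hx']; field_simp
      rw [this, Complex.re_ofReal_mul]
      exact mul_nonpos_of_nonneg_of_nonpos hr.le h1
  by_contra hp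
  set p := star v ⬝ᵥ w with hpdef
  set q := c * (m - l) with hq
  have hq0 : q * p ≠ 0 := mul_ne_zero (mul_ne_zero hc (sub_ne_zero.2 hlm.symm)) hp
  set N := Complex.normSq (q * p) with hN
  have hNpos : 0 < N := Complex.normSq_pos.2 hq0
  have hNc : (N : ℂ) = star (q * p) * (q * p) := Complex.normSq_eq_conj_mul_self
  set W := ∑ i, Complex.normSq (w i)
  have hW : star w ⬝ᵥ w = (W : ℂ) := dot_self_real w
  have key : ∀ s : ℝ, s * N + s ^ 2 * N * W * q.re ≤ 0 := by
    intro s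
    have h := H2 ((1 : ℂ) • v + ((s : ℂ) * star (q * p)) • w)
    have e : A.mulVec ((1 : ℂ) • v + ((s : ℂ) * star (q * p)) • w) =
        l • v + ((s : ℂ) * star (q * p) * m) • w := by
      rw [mulVec_add, mulVec_smul, mulVec_smul, hv, hw, one_smul, smul_smul]
    rw [e, expand_dot, expand_dot, ← hpdef, hW] at h
    have e2 : s * N + s ^ 2 * N * W * q.re = ((s : ℂ) * N + ((s ^ 2 * N * W : ℝ) : ℂ) * q).re := by
      rw [Complex.add_re, Complex.re_ofReal_mul, Complex.re_ofReal_mul, Complex.ofReal_re]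
    rw [e2]
    convert h using 2
    push_cast
    rw [hNc, hq]
    simp only [star_mul, star_star, star_one]
    have : star (s : ℂ) = s := Complex.conj_ofReal s
    rw [this]
    ring
  have hR : 0 < 1 + |W * q.re| := by positivity
  have k1 := key (1 / (1 + |W * q.re|))
  have : 1 / (1 + |W * q.re|) * N + (1 / (1 + |W * q.re|)) ^ 2 * N * W * q.re =
      N * (1 + |W * q.re| + W * q.re) / (1 + |W * q.re|) ^ 2 := by
    field_simp
  rw [this] at k1
  have h5 : 0 < 1 + |W * q.re| + W * q.re := by linarith [neg_abs_le (W * q.re)]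
  have : 0 < N * (1 + |W * q.re| + W * q.re) / (1 + |W * q.re|) ^ 2 := by positivity
  linarith

theorem fov_deleted_meets_side_of_convexoid {n : ℕ} (hn : 1 ≤ n)
    (A : Matrix (Fin (n + 1)) (Fin (n + 1)) ℂ)
    (hconvexoid : fov A = convexHull ℝ (spectrum ℂ A))
    (lam mu : ℂ) (hlam : lam ∈ spectrum ℂ A) (hmu : mu ∈ spectrum ℂ A) (hne : lam ≠ mu)
    (hside : segment ℝ lam mu ⊆ frontier (fov A)) :
    ∀ k : Fin (n + 1), (fov (subAt A k) ∩ segment ℝ lam mu).Nonempty := by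
  intro k
  obtain ⟨c, hc, H⟩ := support_fun (S := fov A) (a := lam)
    (by rw [hconvexoid]; exact convex_convexHull ℝ _)
    (by rw [hconvexoid]; exact subset_convexHull ℝ _ hlam)
    (hside (left_mem_segment ℝ lam mu)).2
  obtain ⟨v, hv0, hv⟩ := exists_eigvec hlam
  obtain ⟨w, hw0, hw⟩ := exists_eigvec hmu
  have ho := orth hc hne H hv hw
  have ho' : star w ⬝ᵥ v = 0 := by
    have := congrArg star ho
    rwa [← star_dotProduct_star, star_star, star_zero] at this
  obtain ⟨a, b, hab, hk⟩ : ∃ a b : ℂ, (a ≠ 0 ∨ b ≠ 0) ∧ a * v k + b * w k = 0 := by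
    by_cases h : w k = 0
    · exact ⟨0, 1, by simp, by simp [h]⟩
    · exact ⟨w k, - v k, Or.inl h, by ring⟩
  set x := a • v + b • w with hx
  have hxk : x k = 0 := by simpa [hx] using hk
  have hV := nsq_pos hv0
  have hW := nsq_pos hw0
  have hV' := dot_self_real v
  have hW' := dot_self_real w
  set V := ∑ i, Complex.normSq (v i)
  set W := ∑ i, Complex.normSq (w i)
  set P := Complex.normSq a * V with hP
  set Q := Complex.normSq b * W with hQ
  have hP0 : 0 ≤ P := mul_nonneg (Complex.normSq_nonneg _) hV.le
  have hQ0 : 0 ≤ Q := mul_nonneg (Complex.normSq_nonneg _) hW.le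
  have hPQ : 0 < P + Q := by
    rcases hab with h | h
    · have : 0 < P := mul_pos (Complex.normSq_pos.2 h) hV
      linarith
    · have : 0 < Q := mul_pos (Complex.normSq_pos.2 h) hW
      linarith
  have hxx : star x ⬝ᵥ x = ((P + Q : ℝ) : ℂ) := by
    rw [hx, expand_dot, ho, ho', hV', hW', hP, hQ]
    push_cast
    rw [Complex.normSq_eq_conj_mul_self, Complex.normSq_eq_conj_mul_self]
    simp
  have hxA : star x ⬝ᵥ A.mulVec x = P * lam + Q * mu := by
    have e : A.mulVec x = (a * lam) • v + (b * mu) • w := by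
      rw [hx, mulVec_add, mulVec_smul, mulVec_smul, hv, hw, smul_smul, smul_smul]
    rw [e, hx, expand_dot, ho, ho', hV', hW', hP, hQ]
    push_cast
    rw [Complex.normSq_eq_conj_mul_self, Complex.normSq_eq_conj_mul_self]
    simp
    ring
  set y : Fin n → ℂ := fun i => x (k.succAbove i) with hy
  have hyy : star y ⬝ᵥ y = ((P + Q : ℝ) : ℂ) := by
    rw [← hxx]
    simp only [dotProduct]
    rw [Fin.sum_univ_succAbove _ k]
    simp [hxk, hy]
  have hyA : star y ⬝ᵥ (subAt A k).mulVec y = P * lam + Q * mu := by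
    rw [← hxA]
    simp only [dotProduct, mulVec]
    rw [Fin.sum_univ_succAbove _ k]
    simp only [Fin.sum_univ_succAbove _ k, hxk, Pi.star_apply]
    simp [hy, subAt]
  refine ⟨_, fov_of_ne (subAt A k) hPQ hyy, P / (P + Q), Q / (P + Q), by positivity,
    by positivity, by field_simp, ?_⟩
  have : ((P + Q : ℝ) : ℂ) ≠ 0 := by exact_mod_cast hPQ.ne'
  rw [hyA]
  simp only [Complex.real_smul]
  push_cast at this ⊢
  field_simp
end

section
/- An n-by-n complex matrix A is convexoid (i.e., F(A) = conv(σ(A))) if and only if A is normal or there exists a unitary matrix U such that U* A U is a block diagonal direct sum A₁ ⊕ A₂ where A₁ is normal and F(A₂) ⊆ F(A₁). -/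
open Matrix Complex

open scoped ComplexOrder in
lemma fv_zero {n : ℕ} {x : Fin n → ℂ} (h : star x ⬝ᵥ x = 0) : x = 0 :=
  dotProduct_star_self_eq_zero.1 h

lemma fv_adj {m n : ℕ} (A : Matrix (Fin m) (Fin n) ℂ) (x : Fin m → ℂ) (y : Fin n → ℂ) :
    star x ⬝ᵥ A *ᵥ y = star (Aᴴ *ᵥ x) ⬝ᵥ y := by
  rw [star_mulVec, dotProduct_mulVec, conjTranspose_conjTranspose]

lemma fv_self {n : ℕ} (x : Fin n → ℂ) :
    star x ⬝ᵥ x = ((∑ i, ‖x i‖ ^ 2 : ℝ) : ℂ) := by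
  simp only [dotProduct, Pi.star_apply, RCLike.star_def, ofReal_sum]
  refine Finset.sum_congr rfl fun i _ => ?_
  rw [Complex.conj_mul']; simp

lemma fv_self' {n : ℕ} (x : Fin n → ℂ) :
    ∃ r : ℝ, 0 ≤ r ∧ star x ⬝ᵥ x = (r : ℂ) := ⟨_, by positivity, fv_self x⟩

lemma fv_unit {n : ℕ} (x : Fin n → ℂ) (hx : x ≠ 0) :
    ∃ c : ℝ, 0 < c ∧ star x ⬝ᵥ x = ((c ^ 2 : ℝ) : ℂ) ∧
      star (((c⁻¹ : ℝ) : ℂ) • x) ⬝ᵥ (((c⁻¹ : ℝ) : ℂ) • x) = 1 := by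
  obtain ⟨r, hr, h⟩ := fv_self' x
  have hr0 : r ≠ 0 := by
    rintro rfl
    exact hx (fv_zero (by rw [h]; simp))
  have hp : 0 < r := lt_of_le_of_ne hr hr0.symm
  refine ⟨√r, Real.sqrt_pos.2 hp, by rw [Real.sq_sqrt hr, h], ?_⟩
  rw [star_smul, smul_dotProduct, dotProduct_smul, h]
  simp only [RCLike.star_def, conj_ofReal, smul_eq_mul]
  norm_cast
  have := Real.mul_self_sqrt hr
  have h2 : √r ≠ 0 := (Real.sqrt_pos.2 hp).ne'
  field_simp
  nlinarith

lemma fv_eig {n : ℕ} (A : Matrix (Fin n) (Fin n) ℂ) (μ : ℂ) :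
    μ ∈ spectrum ℂ A ↔ ∃ x : Fin n → ℂ, x ≠ 0 ∧ A *ᵥ x = μ • x := by
  rw [← Matrix.spectrum_toLin', ← Module.End.hasEigenvalue_iff_mem_spectrum]
  constructor
  · intro h
    obtain ⟨x, hx⟩ := h.exists_hasEigenvector
    exact ⟨x, hx.2, by simpa using hx.apply_eq_smul⟩
  · rintro ⟨x, h0, hx⟩
    exact Module.End.hasEigenvalue_of_hasEigenvector (x := x)
      ⟨Module.End.mem_eigenspace_iff.2 (by simpa using hx), h0⟩

lemma fv_eig1 {n : ℕ} (A : Matrix (Fin n) (Fin n) ℂ) (μ : ℂ) (h : μ ∈ spectrum ℂ A) :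
    ∃ x : Fin n → ℂ, star x ⬝ᵥ x = 1 ∧ A *ᵥ x = μ • x := by
  obtain ⟨x, h0, hx⟩ := (fv_eig A μ).1 h
  obtain ⟨c, hc, -, h1⟩ := fv_unit x h0
  exact ⟨_, h1, by rw [mulVec_smul, hx, smul_comm]⟩

lemma fv_spec_sub {n : ℕ} (A : Matrix (Fin n) (Fin n) ℂ) : spectrum ℂ A ⊆ fov A := by
  intro μ h
  obtain ⟨x, h1, hx⟩ := fv_eig1 A μ h
  refine ⟨x, h1, ?_⟩
  rw [hx, dotProduct_smul, h1]; simp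

lemma fv_orth {n : ℕ} (A : Matrix (Fin n) (Fin n) ℂ) {x y : Fin n → ℂ} {l m : ℂ}
    (hx : Aᴴ *ᵥ x = star l • x) (hy : A *ᵥ y = m • y) (h : l ≠ m) : star x ⬝ᵥ y = 0 := by
  have := fv_adj A x y
  rw [hx, hy, star_smul, star_star, dotProduct_smul, smul_dotProduct, smul_eq_mul, smul_eq_mul,
    ← sub_eq_zero, ← sub_mul] at this
  exact (mul_eq_zero.1 this).resolve_left (sub_ne_zero.2 h.symm)

lemma fv_normal_zero {n : ℕ} (A : Matrix (Fin n) (Fin n) ℂ) (hA : Aᴴ * A = A * Aᴴ)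
    {x : Fin n → ℂ} : A *ᵥ x = 0 → Aᴴ *ᵥ x = 0 := by
  intro h
  have h1 : star (Aᴴ *ᵥ x) ⬝ᵥ (Aᴴ *ᵥ x) = 0 := by
    rw [← fv_adj, mulVec_mulVec, ← hA, ← mulVec_mulVec, h]; simp
  exact fv_zero h1

lemma fv_normal_shift {n : ℕ} (A : Matrix (Fin n) (Fin n) ℂ) (hA : Aᴴ * A = A * Aᴴ) (μ : ℂ) :
    (A - μ • 1)ᴴ * (A - μ • 1) = (A - μ • 1) * (A - μ • 1)ᴴ := by
  simp only [conjTranspose_sub, conjTranspose_smul, conjTranspose_one, sub_mul, mul_sub, hA,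
    smul_mul_assoc, mul_smul_comm, one_mul, mul_one, smul_sub]
  rw [smul_comm μ (star μ)]; abel

lemma fv_normal_eig {n : ℕ} (A : Matrix (Fin n) (Fin n) ℂ) (hA : Aᴴ * A = A * Aᴴ)
    {x : Fin n → ℂ} {μ : ℂ} (h : A *ᵥ x = μ • x) : Aᴴ *ᵥ x = star μ • x := by
  have := fv_normal_zero _ (fv_normal_shift A hA μ) (x := x)
    (by simp [sub_mulVec, smul_mulVec, h])
  simpa [sub_mulVec, smul_mulVec, sub_eq_zero] using this

lemma fv_normal_sq {n : ℕ} (A : Matrix (Fin n) (Fin n) ℂ) (hA : Aᴴ * A = A * Aᴴ)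
    {x : Fin n → ℂ} (h : A *ᵥ (A *ᵥ x) = 0) : A *ᵥ x = 0 := by
  have h1 := fv_normal_zero A hA h
  have h2 : star (A *ᵥ x) ⬝ᵥ (A *ᵥ x) = 0 := by
    rw [fv_adj, h1]; simp
  exact fv_zero h2

lemma fv_normal_pow {n : ℕ} (A : Matrix (Fin n) (Fin n) ℂ) (hA : Aᴴ * A = A * Aᴴ)
    {x : Fin n → ℂ} (k : ℕ) (h : (A ^ k) *ᵥ x = 0) : A *ᵥ x = 0 := by
  induction k with
  | zero => simp at h; simp [h]
  | succ k ih =>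
    cases k with
    | zero => simpa using h
    | succ k =>
      apply ih
      rw [pow_succ', ← mulVec_mulVec]
      apply fv_normal_sq A hA
      rwa [mulVec_mulVec, mulVec_mulVec, mul_assoc, ← pow_succ', ← pow_succ']

lemma fv_normal_top {n : ℕ} (A : Matrix (Fin n) (Fin n) ℂ) (hA : Aᴴ * A = A * Aᴴ) :
    ⨆ μ : ℂ, Module.End.eigenspace (Matrix.toLin' A) μ = ⊤ := by
  rw [← Module.End.iSup_maxGenEigenspace_eq_top (Matrix.toLin' A)]
  congr 1
  ext1 μ
  apply le_antisymm
  · exact Module.End.genEigenspace_le_maximal _ _ _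
  · intro x hx
    rw [Module.End.mem_maxGenEigenspace] at hx
    obtain ⟨k, hk⟩ := hx
    have e : Matrix.toLin' A - μ • 1 = Matrix.toLin' (A - μ • 1) := by
      simp [map_sub, Matrix.toLin'_one]; rfl
    rw [e, ← Matrix.toLin'_pow, Matrix.toLin'_apply] at hk
    have := fv_normal_pow _ (fv_normal_shift A hA μ) k hk
    rw [Module.End.mem_eigenspace_iff, Matrix.toLin'_apply]
    simpa [sub_mulVec, smul_mulVec, sub_eq_zero] using this

lemma fv_sum {n : ℕ} (A : Matrix (Fin n) (Fin n) ℂ) (s : Finset ℂ) (f : ℂ → Fin n → ℂ)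
    (h1 : ∀ μ ∈ s, A *ᵥ f μ = μ • f μ) (h2 : ∀ μ ∈ s, Aᴴ *ᵥ f μ = star μ • f μ) (g : ℂ → ℂ) :
    star (∑ μ ∈ s, f μ) ⬝ᵥ (∑ μ ∈ s, g μ • f μ) = ∑ μ ∈ s, g μ * (star (f μ) ⬝ᵥ f μ) := by
  rw [dotProduct_sum]
  refine Finset.sum_congr rfl fun m hm => ?_
  rw [dotProduct_smul, smul_eq_mul, star_sum, sum_dotProduct, Finset.sum_eq_single m]
  · intro l hl hne
    exact fv_orth A (h2 l hl) (h1 m hm) hne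
  · exact fun h => absurd hm h

lemma fv_sum1 {n : ℕ} (A : Matrix (Fin n) (Fin n) ℂ) (s : Finset ℂ) (f : ℂ → Fin n → ℂ)
    (h1 : ∀ μ ∈ s, A *ᵥ f μ = μ • f μ) (h2 : ∀ μ ∈ s, Aᴴ *ᵥ f μ = star μ • f μ) :
    star (∑ μ ∈ s, f μ) ⬝ᵥ (∑ μ ∈ s, f μ) = ∑ μ ∈ s, (star (f μ) ⬝ᵥ f μ) := by
  simpa using fv_sum A s f h1 h2 (fun _ => 1)

lemma fv_sum2 {n : ℕ} (A : Matrix (Fin n) (Fin n) ℂ) (s : Finset ℂ) (f : ℂ → Fin n → ℂ)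
    (h1 : ∀ μ ∈ s, A *ᵥ f μ = μ • f μ) (h2 : ∀ μ ∈ s, Aᴴ *ᵥ f μ = star μ • f μ) :
    star (∑ μ ∈ s, f μ) ⬝ᵥ A *ᵥ (∑ μ ∈ s, f μ) = ∑ μ ∈ s, μ * (star (f μ) ⬝ᵥ f μ) := by
  rw [mulVec_sum, Finset.sum_congr rfl h1]
  exact fv_sum A s f h1 h2 id

lemma fv_normal {n : ℕ} (A : Matrix (Fin n) (Fin n) ℂ) (hA : Aᴴ * A = A * Aᴴ) :
    fov A = convexHull ℝ (spectrum ℂ A) := by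
  apply Set.Subset.antisymm
  · rintro z ⟨x, hx1, rfl⟩
    have hx : x ∈ ⨆ μ : ℂ, Module.End.eigenspace (Matrix.toLin' A) μ := by
      rw [fv_normal_top A hA]; trivial
    obtain ⟨f, hf, rfl⟩ := (Submodule.mem_iSup_iff_exists_finsupp _ _).1 hx
    have h1 : ∀ μ ∈ f.support, A *ᵥ f μ = μ • f μ := fun μ _ => by
      simpa [Module.End.mem_eigenspace_iff] using hf μ
    have h2 : ∀ μ ∈ f.support, Aᴴ *ᵥ f μ = star μ • f μ := fun μ h =>
      fv_normal_eig A hA (h1 μ h)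
    simp only [Finsupp.sum] at hx1 ⊢
    rw [fv_sum1 A _ _ h1 h2] at hx1
    rw [fv_sum2 A _ _ h1 h2]
    choose r hr0 hr using fun μ => fv_self' (f μ)
    simp only [hr] at hx1 ⊢
    have : ∑ μ ∈ f.support, μ * (r μ : ℂ) = ∑ μ ∈ f.support, r μ • μ :=
      Finset.sum_congr rfl fun μ _ => by rw [Complex.real_smul, mul_comm]
    rw [this]
    refine (convex_convexHull ℝ _).sum_mem (fun μ _ => hr0 μ) (by exact_mod_cast hx1) ?_
    intro μ hμ
    exact subset_convexHull _ _ ((fv_eig A μ).2 ⟨f μ, by simpa using hμ, h1 μ hμ⟩)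
  · intro z hz
    have hfin := Matrix.finite_spectrum A
    rw [← hfin.coe_toFinset, Finset.mem_convexHull'] at hz
    obtain ⟨w, hw0, hw1, rfl⟩ := hz
    have : ∀ μ : ℂ, ∃ x : Fin n → ℂ, μ ∈ hfin.toFinset → star x ⬝ᵥ x = 1 ∧ A *ᵥ x = μ • x := by
      intro μ
      by_cases h : μ ∈ hfin.toFinset
      · obtain ⟨x, hx⟩ := fv_eig1 A μ (by simpa using h)
        exact ⟨x, fun _ => hx⟩
      · exact ⟨0, fun h' => absurd h' h⟩
    choose x hx using this
    let f : ℂ → Fin n → ℂ := fun μ => ((√(w μ) : ℝ) : ℂ) • x μ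
    have h1 : ∀ μ ∈ hfin.toFinset, A *ᵥ f μ = μ • f μ := fun μ h => by
      simp only [f]; rw [mulVec_smul, (hx μ h).2, smul_comm]
    have h2 : ∀ μ ∈ hfin.toFinset, Aᴴ *ᵥ f μ = star μ • f μ := fun μ h =>
      fv_normal_eig A hA (h1 μ h)
    have h3 : ∀ μ ∈ hfin.toFinset, star (f μ) ⬝ᵥ f μ = w μ := fun μ h => by
      simp only [f]
      rw [star_smul, smul_dotProduct, dotProduct_smul, (hx μ h).1]
      simp only [RCLike.star_def, conj_ofReal, smul_eq_mul, mul_one]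
      rw [← ofReal_mul, Real.mul_self_sqrt (hw0 μ h)]
    refine ⟨∑ μ ∈ hfin.toFinset, f μ, ?_, ?_⟩
    · rw [fv_sum1 A _ _ h1 h2, Finset.sum_congr rfl h3]
      exact_mod_cast hw1
    · rw [fv_sum2 A _ _ h1 h2]
      refine Finset.sum_congr rfl fun μ h => ?_
      rw [h3 μ h, Complex.real_smul, mul_comm]

lemma fv_compress {m n : ℕ} (A : Matrix (Fin n) (Fin n) ℂ) (J : Matrix (Fin n) (Fin m) ℂ)
    (hJ : Jᴴ * J = 1) : fov (Jᴴ * A * J) ⊆ fov A := by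
  rintro z ⟨x, h1, rfl⟩
  refine ⟨J *ᵥ x, ?_, ?_⟩
  · rw [fv_adj, mulVec_mulVec, hJ, one_mulVec, h1]
  · rw [star_mulVec, ← dotProduct_mulVec, mulVec_mulVec, mulVec_mulVec]

lemma fv_ext_red {n : ℕ} (A : Matrix (Fin n) (Fin n) ℂ) (hA : fov A = convexHull ℝ (spectrum ℂ A))
    (l : ℂ) (hl : l ∈ (convexHull ℝ (spectrum ℂ A)).extremePoints ℝ) (x : Fin n → ℂ)
    (hx : A *ᵥ x = l • x) : Aᴴ *ᵥ x = star l • x := by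
  have hfin := Matrix.finite_spectrum A
  obtain ⟨w, hw0, hw⟩ : ∃ w : ℂ, w ≠ 0 ∧ ∀ μ ∈ spectrum ℂ A, (star w * μ).re ≤ (star w * l).re := by
    by_cases hs : ∃ μ ∈ spectrum ℂ A, μ ≠ l
    · obtain ⟨μ₀, hμ₀, hne⟩ := hs
      have hnot : l ∉ convexHull ℝ (spectrum ℂ A \ {l}) := fun h =>
        ((convex_convexHull ℝ _).mem_extremePoints_iff_mem_sdiff_convexHull_sdiff.1 hl).2
          (convexHull_mono (Set.sdiff_subset_sdiff_left (subset_convexHull ℝ _)) h)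
      obtain ⟨f, u, h1, h2⟩ := geometric_hahn_banach_closed_point (convex_convexHull ℝ _)
        ((hfin.sdiff (t := {l})).isClosed_convexHull ℝ) hnot
      have hf : ∀ z : ℂ, f z = (star (⟨f 1, f I⟩ : ℂ) * z).re := by
        intro z
        have : z = z.re • (1 : ℂ) + z.im • I := by
          simp [Complex.re_add_im]
        conv_lhs => rw [this]
        rw [map_add, map_smul, map_smul]
        simp; ring
      have h3 : ∀ μ ∈ spectrum ℂ A, μ ≠ l → f μ < f l := fun μ h h' =>
        (h1 μ (subset_convexHull _ _ ⟨h, h'⟩)).trans h2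
      refine ⟨⟨f 1, f I⟩, ?_, ?_⟩
      · intro h0
        have := h3 μ₀ hμ₀ hne
        rw [hf μ₀, hf l, h0] at this
        simp at this
      · intro μ hμ
        rw [← hf, ← hf]
        by_cases h : μ = l
        · rw [h]
        · exact (h3 μ hμ h).le
    · push Not at hs
      exact ⟨1, one_ne_zero, fun μ h => by rw [hs μ h]⟩
  -- the numerical range is in the half plane
  have hF : ∀ z ∈ fov A, (star w * z).re ≤ (star w * l).re := by
    intro z hz
    rw [hA] at hz
    have hc : Convex ℝ {z : ℂ | (star w * z).re ≤ (star w * l).re} := by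
      apply convex_halfSpace_le
      constructor
      · intro a b; simp [mul_add]
      · intro c a; simp only [Complex.real_smul]; rw [mul_left_comm, re_ofReal_mul, smul_eq_mul]
    exact convexHull_min hw hc hz
  set B := A - l • (1 : Matrix (Fin n) (Fin n) ℂ) with hB
  have hBx : B *ᵥ x = 0 := by simp [hB, sub_mulVec, smul_mulVec, hx]
  have hG : ∀ y : Fin n → ℂ, (star w * (star y ⬝ᵥ B *ᵥ y)).re ≤ 0 := by
    intro y
    by_cases hy : y = 0
    · simp [hy]
    obtain ⟨c, hc, h1, h2⟩ := fv_unit y hy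
    have h3 := hF _ ⟨_, h2, rfl⟩
    have e : star y ⬝ᵥ B *ᵥ y = ((c ^ 2 : ℝ) : ℂ) *
        (star (((c⁻¹ : ℝ) : ℂ) • y) ⬝ᵥ A *ᵥ (((c⁻¹ : ℝ) : ℂ) • y) - l) := by
      rw [hB, sub_mulVec, dotProduct_sub, smul_mulVec, one_mulVec, dotProduct_smul, h1,
        star_smul, mulVec_smul, smul_dotProduct, dotProduct_smul]
      simp only [RCLike.star_def, conj_ofReal, smul_eq_mul]
      have : (c : ℂ) ≠ 0 := by exact_mod_cast hc.ne'
      push_cast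
      field_simp
    rw [e, mul_left_comm, re_ofReal_mul, mul_sub, sub_re]
    exact mul_nonpos_of_nonneg_of_nonpos (by positivity) (by linarith)
  have hL : ∀ u : Fin n → ℂ, (star w * (star x ⬝ᵥ B *ᵥ u)).re ≤ 0 := by
    intro u
    by_contra! hpos
    set L := (star w * (star x ⬝ᵥ B *ᵥ u)).re
    set Q := (star w * (star u ⬝ᵥ B *ᵥ u)).re with hQ
    have key : ∀ t : ℝ, t * L + t ^ 2 * Q ≤ 0 := by
      intro t
      have := hG (x + (t : ℂ) • u)
      rw [mulVec_add, hBx, zero_add, mulVec_smul, star_add, add_dotProduct, star_smul,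
        smul_dotProduct, dotProduct_smul, dotProduct_smul] at this
      simp only [RCLike.star_def, conj_ofReal, smul_eq_mul] at this
      convert this using 1
      simp only [L, hQ, RCLike.star_def]
      rw [mul_add, add_re, mul_left_comm, re_ofReal_mul, mul_left_comm, re_ofReal_mul,
        mul_left_comm, re_ofReal_mul]
      ring
    have h1 := key (L / (|Q| + 1))
    have hq : 0 < |Q| + 1 := by positivity
    have h2 : 0 < L / (|Q| + 1) := by positivity
    set t := L / (|Q| + 1) with ht
    have h3 : t * (|Q| + 1) = L := by rw [ht]; field_simp
    have h4 : t * Q ≥ - (t * |Q|) := by nlinarith [neg_abs_le Q]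
    have h5 : L + t * Q > 0 := by nlinarith
    nlinarith [mul_pos h2 h5]
  have h := hL (w • (Bᴴ *ᵥ x))
  rw [fv_adj, dotProduct_smul, smul_eq_mul, ← mul_assoc] at h
  have hz : Bᴴ *ᵥ x = 0 := by
    by_contra hne
    obtain ⟨c, hc, h1, -⟩ := fv_unit _ hne
    rw [h1, RCLike.star_def, Complex.conj_mul', ← ofReal_pow, ← ofReal_mul, ofReal_re] at h
    have : 0 < ‖w‖ := norm_pos_iff.2 hw0
    have : 0 < ‖w‖ ^ 2 * c ^ 2 := by positivity
    linarith
  simpa [hB, sub_mulVec, smul_mulVec, sub_eq_zero] using hz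

lemma fv_sum_mem {p q n : ℕ} (e : Fin p ⊕ Fin q ≃ Fin n) (A₁ : Matrix (Fin p) (Fin p) ℂ)
    (A₂ : Matrix (Fin q) (Fin q) ℂ) (hc : Convex ℝ (fov A₁)) (h : fov A₂ ⊆ fov A₁) :
    fov (Matrix.reindex e e (Matrix.fromBlocks A₁ 0 0 A₂)) ⊆ fov A₁ := by
  rintro z ⟨x, h1, rfl⟩
  obtain ⟨y₁, y₂, rfl⟩ : ∃ y₁ y₂, x = Sum.elim y₁ y₂ ∘ e.symm := by
    refine ⟨x ∘ e ∘ Sum.inl, x ∘ e ∘ Sum.inr, ?_⟩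
    ext i
    obtain ⟨j, rfl⟩ := e.surjective i
    rcases j with j | j <;> simp
  have hs : star (Sum.elim y₁ y₂ ∘ e.symm) = Sum.elim (star y₁) (star y₂) ∘ e.symm := by
    ext i
    obtain ⟨j, rfl⟩ := e.surjective i
    rcases j with j | j <;> simp
  have hM : (Matrix.reindex e e (Matrix.fromBlocks A₁ 0 0 A₂)) *ᵥ (Sum.elim y₁ y₂ ∘ e.symm)
      = Sum.elim (A₁ *ᵥ y₁) (A₂ *ᵥ y₂) ∘ e.symm := by
    rw [reindex_apply, submatrix_mulVec_equiv, fromBlocks_mulVec]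
    simp [Function.comp_assoc]
  rw [hM, hs, ← dotProduct_comp_equiv_symm, Function.comp_assoc]
  rw [hs, ← dotProduct_comp_equiv_symm, Function.comp_assoc] at h1
  simp only [Equiv.symm_comp_self, Equiv.symm_symm, Function.comp_id,
    sumElim_dotProduct_sumElim] at h1 ⊢
  have key : ∀ {m : ℕ} (B : Matrix (Fin m) (Fin m) ℂ) (y : Fin m → ℂ), y ≠ 0 →
      ∃ r : ℝ, 0 ≤ r ∧ star y ⬝ᵥ y = r ∧ ∃ f ∈ fov B, star y ⬝ᵥ B *ᵥ y = r • f := by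
    intro m B y hy
    obtain ⟨c, hc, h1, h2⟩ := fv_unit y hy
    refine ⟨c ^ 2, by positivity, h1, _, ⟨_, h2, rfl⟩, ?_⟩
    rw [star_smul, mulVec_smul, smul_dotProduct, dotProduct_smul]
    simp only [RCLike.star_def, conj_ofReal, smul_eq_mul, Complex.real_smul]
    have : (c : ℂ) ≠ 0 := by exact_mod_cast hc.ne'
    push_cast
    field_simp
  by_cases hy1 : y₁ = 0
  · subst hy1
    refine h ⟨y₂, ?_, ?_⟩
    · simpa using h1
    · simp
  by_cases hy2 : y₂ = 0
  · subst hy2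
    refine ⟨y₁, ?_, ?_⟩
    · simpa using h1
    · simp
  obtain ⟨r, hr, hr1, f, hf, hf1⟩ := key A₁ y₁ hy1
  obtain ⟨s, hs, hs1, g, hg, hg1⟩ := key A₂ y₂ hy2
  rw [hf1, hg1]
  rw [hr1, hs1] at h1
  exact hc hf (h hg) hr hs (by exact_mod_cast h1)

lemma fv_backward {p q n : ℕ} (A : Matrix (Fin n) (Fin n) ℂ) (e : Fin p ⊕ Fin q ≃ Fin n)
    (U : Matrix (Fin n) (Fin n) ℂ)
    (A₁ : Matrix (Fin p) (Fin p) ℂ) (A₂ : Matrix (Fin q) (Fin q) ℂ)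
    (hU : Uᴴ * U = 1)
    (hM : Uᴴ * A * U = Matrix.reindex e e (Matrix.fromBlocks A₁ 0 0 A₂))
    (hN : A₁ᴴ * A₁ = A₁ * A₁ᴴ) (hF : fov A₂ ⊆ fov A₁) :
    fov A = convexHull ℝ (spectrum ℂ A) := by
  have hU' : U * Uᴴ = 1 := mul_eq_one_comm.1 hU
  have h1 := fv_normal A₁ hN
  have hc : Convex ℝ (fov A₁) := by rw [h1]; exact convex_convexHull ℝ _
  have hA : A = Uᴴᴴ * (Uᴴ * A * U) * Uᴴ := by
    rw [conjTranspose_conjTranspose, mul_assoc, mul_assoc, hU', mul_one, ← mul_assoc, hU', one_mul]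
  have hsub : fov A ⊆ fov A₁ := by
    refine Set.Subset.trans ?_ (fv_sum_mem e A₁ A₂ hc hF)
    rw [← hM]
    conv_lhs => rw [hA]
    exact fv_compress _ _ (by rw [conjTranspose_conjTranspose, hU'])
  have hspec : spectrum ℂ A₁ ⊆ spectrum ℂ A := by
    intro μ hμ
    obtain ⟨y, hy, hyμ⟩ := (fv_eig _ _).1 hμ
    have hv : (Matrix.reindex e e (Matrix.fromBlocks A₁ 0 0 A₂)) *ᵥ (Sum.elim y 0 ∘ e.symm)
        = μ • (Sum.elim y 0 ∘ e.symm) := by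
      rw [reindex_apply, submatrix_mulVec_equiv, fromBlocks_mulVec]
      ext i
      obtain ⟨j, rfl⟩ := e.surjective i
      rcases j with j | j <;> simp [Function.comp_assoc, hyμ]
    rw [← hM] at hv
    refine (fv_eig _ _).2 ⟨U *ᵥ (Sum.elim y 0 ∘ e.symm), ?_, ?_⟩
    · intro h0
      have : Uᴴ *ᵥ (U *ᵥ (Sum.elim y 0 ∘ e.symm)) = 0 := by rw [h0]; simp
      rw [mulVec_mulVec, hU, one_mulVec] at this
      apply hy
      ext i
      simpa using congrFun this (e (Sum.inl i))
    · have := congrArg (fun v => U *ᵥ v) hv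
      simp only [mulVec_mulVec, mulVec_smul] at this
      rw [← this, mulVec_mulVec, ← mul_assoc, ← mul_assoc, hU', one_mul]
  have hsup : fov A₁ ⊆ fov A := by
    have hJ : (U.submatrix id (e ∘ Sum.inl))ᴴ * (U.submatrix id (e ∘ Sum.inl)) = 1 := by
      have := congrArg (fun M => M.submatrix (e ∘ Sum.inl) (e ∘ Sum.inl)) hU
      simp only [submatrix_mul _ _ _ id _ Function.bijective_id] at this
      rw [conjTranspose_submatrix, this]
      exact submatrix_one _ (e.injective.comp Sum.inl_injective)
    have hJ2 : (U.submatrix id (e ∘ Sum.inl))ᴴ * A * (U.submatrix id (e ∘ Sum.inl)) = A₁ := by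
      have := congrArg (fun M => M.submatrix (e ∘ Sum.inl) (e ∘ Sum.inl)) hM
      simp only [submatrix_mul _ _ _ id _ Function.bijective_id] at this
      rw [submatrix_id_id] at this
      rw [conjTranspose_submatrix, this]
      ext i j
      simp
    conv_lhs => rw [← hJ2]
    exact fv_compress _ _ hJ
  apply Set.Subset.antisymm
  · refine hsub.trans ?_
    rw [h1]
    exact convexHull_mono hspec
  · exact (convexHull_min ((fv_spec_sub A).trans hsub) hc).trans hsup

lemma fv_forward {n : ℕ} (A : Matrix (Fin n) (Fin n) ℂ)
    (hA : fov A = convexHull ℝ (spectrum ℂ A)) :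
    ∃ (p q : ℕ) (e : Fin p ⊕ Fin q ≃ Fin n)
          (U : Matrix (Fin n) (Fin n) ℂ)
          (A₁ : Matrix (Fin p) (Fin p) ℂ) (A₂ : Matrix (Fin q) (Fin q) ℂ),
          Uᴴ * U = 1 ∧
          Uᴴ * A * U = Matrix.reindex e e (Matrix.fromBlocks A₁ 0 0 A₂) ∧
          A₁ᴴ * A₁ = A₁ * A₁ᴴ ∧ fov A₂ ⊆ fov A₁ := by
  have hfin := Matrix.finite_spectrum A
  set K := convexHull ℝ (spectrum ℂ A) with hK
  have hSs : K.extremePoints ℝ ⊆ spectrum ℂ A := extremePoints_convexHull_subset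
  have hSf : (K.extremePoints ℝ).Finite := hfin.subset hSs
  have hKM : convexHull ℝ (K.extremePoints ℝ) = K := by
    rw [← (hSf.isClosed_convexHull ℝ).closure_eq]
    exact closure_convexHull_extremePoints (hfin.isCompact_convexHull ℝ) (convex_convexHull ℝ _)
  obtain ⟨p, d, hdinj, hdr⟩ := hSf.fin_param
  have hd : ∀ i, d i ∈ K.extremePoints ℝ := fun i => hdr ▸ Set.mem_range_self i
  choose x hx1 hx2 using fun i => fv_eig1 A (d i) (hSs (hd i))
  have hx3 : ∀ i, Aᴴ *ᵥ x i = star (d i) • x i := fun i => fv_ext_red A hA _ (hd i) _ (hx2 i)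
  have hin : ∀ a b : EuclideanSpace ℂ (Fin n), inner ℂ a b = star a.ofLp ⬝ᵥ b.ofLp := fun a b => by
    rw [EuclideanSpace.inner_eq_star_dotProduct, dotProduct_comm]
  have hv : Orthonormal ℂ (fun i => (WithLp.toLp 2 (x i) : EuclideanSpace ℂ (Fin n))) := by
    rw [orthonormal_iff_ite]
    intro i j
    rw [hin]
    split_ifs with h
    · subst h; exact hx1 i
    · exact fv_orth A (hx3 i) (hx2 j) (fun h' => h (hdinj h'))
  have hpn : p ≤ n := by simpa using hv.linearIndependent.fintype_card_le_finrank
  obtain ⟨q, rfl⟩ := Nat.exists_eq_add_of_le hpn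
  let e : Fin p ⊕ Fin q ≃ Fin (p + q) := finSumFinEquiv
  let v : Fin (p + q) → EuclideanSpace ℂ (Fin (p + q)) := fun i =>
    Sum.elim (fun i => WithLp.toLp 2 (x i)) (fun _ => 0) (e.symm i)
  have hvs : Orthonormal ℂ ((Set.range (e ∘ Sum.inl)).domRestrict v) := by
    rw [orthonormal_iff_ite] at hv ⊢
    rintro ⟨_, i, rfl⟩ ⟨_, j, rfl⟩
    have := hv i j
    simpa [v, Set.domRestrict] using this
  obtain ⟨b, hb⟩ := hvs.exists_orthonormalBasis_extension_of_card_eq (by simp)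
  have hb' : ∀ i, (b (e (Sum.inl i))).ofLp = x i := fun i => by
    rw [hb (e (Sum.inl i)) ⟨i, rfl⟩]; simp [v]
  let U : Matrix (Fin (p + q)) (Fin (p + q)) ℂ := Matrix.of fun i j => b j i
  have hUA : ∀ (B : Matrix (Fin (p + q)) (Fin (p + q)) ℂ) i j,
      (Uᴴ * B * U) i j = star (b i).ofLp ⬝ᵥ B *ᵥ (b j).ofLp := by
    intro B i j
    rw [mul_assoc, mul_apply]
    simp [U, dotProduct, mulVec, mul_apply]
  have hU : Uᴴ * U = 1 := by
    ext i j
    have := hUA 1 i j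
    rw [mul_one, one_mulVec, ← hin, orthonormal_iff_ite.1 b.orthonormal] at this
    rw [this, one_apply]
  have hbb : ∀ i j, star (b i).ofLp ⬝ᵥ (b j).ofLp = if i = j then 1 else 0 := fun i j => by
    rw [← hin, orthonormal_iff_ite.1 b.orthonormal]
  refine ⟨p, q, e, U, diagonal d, (Uᴴ * A * U).submatrix (e ∘ Sum.inr) (e ∘ Sum.inr), hU, ?_, ?_, ?_⟩
  · ext i j
    obtain ⟨i, rfl⟩ := e.surjective i
    obtain ⟨j, rfl⟩ := e.surjective j
    have hL : ∀ (i : Fin p) j, (Uᴴ * A * U) (e (Sum.inl i)) j = if e (Sum.inl i) = j then d i else 0 := by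
      intro i j
      rw [hUA, fv_adj, hb', hx3, ← hb', star_smul, smul_dotProduct, hbb, star_star]
      simp
    have hR : ∀ i (j : Fin p), (Uᴴ * A * U) i (e (Sum.inl j)) = if i = e (Sum.inl j) then d j else 0 := by
      intro i j
      rw [hUA, hb', hx2, ← hb', dotProduct_smul, hbb]
      simp
    rcases i with i | i
    · rw [hL]
      rcases j with j | j <;> simp [diagonal_apply]
    · rcases j with j | j
      · rw [hR]; simp
      · simp
  · rw [diagonal_conjTranspose, diagonal_mul_diagonal, diagonal_mul_diagonal]
    simp only [mul_comm]
  · have hd : fov (diagonal d) = K := by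
      rw [fv_normal, spectrum_diagonal, hdr, hKM]
      rw [diagonal_conjTranspose, diagonal_mul_diagonal, diagonal_mul_diagonal]
      simp only [mul_comm]
    rw [hd, ← hA]
    have hJ : (U.submatrix id (e ∘ Sum.inr))ᴴ * (U.submatrix id (e ∘ Sum.inr)) = 1 := by
      have := congrArg (fun M => M.submatrix (e ∘ Sum.inr) (e ∘ Sum.inr)) hU
      simp only [submatrix_mul _ _ _ id _ Function.bijective_id] at this
      rw [conjTranspose_submatrix, this]
      exact submatrix_one _ (e.injective.comp Sum.inr_injective)
    rw [submatrix_mul _ _ _ id _ Function.bijective_id,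
      submatrix_mul _ _ _ id _ Function.bijective_id, submatrix_id_id]
    exact fv_compress A _ hJ

/-- Johnson's characterization: `A` is convexoid (i.e. `F(A) = conv(σ(A))`) if and only if
`A` is normal, or `A` is unitarily similar to a direct sum `A₁ ⊕ A₂` with `A₁` normal and
`F(A₂) ⊆ F(A₁)`. -/
theorem convexoid_iff_normal_or_directSum {n : ℕ} (A : Matrix (Fin n) (Fin n) ℂ) :
    fov A = convexHull ℝ (spectrum ℂ A) ↔
      (Aᴴ * A = A * Aᴴ ∨
        ∃ (p q : ℕ) (e : Fin p ⊕ Fin q ≃ Fin n)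
          (U : Matrix (Fin n) (Fin n) ℂ)
          (A₁ : Matrix (Fin p) (Fin p) ℂ) (A₂ : Matrix (Fin q) (Fin q) ℂ),
          Uᴴ * U = 1 ∧
          Uᴴ * A * U = Matrix.reindex e e (Matrix.fromBlocks A₁ 0 0 A₂) ∧
          A₁ᴴ * A₁ = A₁ * A₁ᴴ ∧ fov A₂ ⊆ fov A₁) := by
  constructor
  · exact fun h => Or.inr (fv_forward A h)
  · rintro (h | ⟨p, q, e, U, A₁, A₂, hU, hM, hN, hF⟩)
    · exact fv_normal A h
    · exact fv_backward A e U A₁ A₂ hU hM hN hF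
end
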